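/- arXiv:2605.05189 — 2 statements merged into one kernel-verified Lean document; each statement's English description precedes it below -/
import Mathlib

section
/- Let u, v ∈ ℝ^d be independent random vectors each distributed N(0, I_d/d), and let T : ℝ^{d×d} → ℝ^{d×d} be a fixed self-adjoint linear operator (with respect to the Frobenius inner product). Then for every p ∈ [1,∞) there exists a constant C_p, independent of d and of T, such that E[ | ⟨uv^⊤, T[uv^⊤]⟩_F − tr(T)/d² |^p ]^{1/p} ≤ C_p · ‖T‖_op / √d, where tr(T) is the trace of T as an operator on the d²-dimensional space ℝ^{d×d} and ‖T‖_op its operator norm with respect to the Frobenius norm. -/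
open MeasureTheory ProbabilityTheory Matrix

noncomputable section

/-- The law `N(0, I_d/d)` on `ℝ^d`. -/
def stdGaussianVec (d : ℕ) : Measure (Fin d → ℝ) :=
  Measure.pi fun _ => gaussianReal 0 (d : NNReal)⁻¹

/-- The Frobenius inner product `⟨A, B⟩_F = Σ_{a,b} A_{ab} B_{ab}`. -/
def finner {d : ℕ} (A B : Matrix (Fin d) (Fin d) ℝ) : ℝ :=
  ∑ a, ∑ b, A a b * B a b

lemma add_rpow_aux {a b p : ℝ} (ha : 0 ≤ a) (hb : 0 ≤ b) (hp : 1 ≤ p) :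
    (a + b) ^ p ≤ 2 ^ (p - 1) * (a ^ p + b ^ p) := by
  have := NNReal.rpow_add_le_mul_rpow_add_rpow ⟨a, ha⟩ ⟨b, hb⟩ hp
  exact_mod_cast this

lemma exp_aux (s : ℝ) (hs : |s| ≤ 1/4) :
    Real.exp (-s) * Real.sqrt (1 / (1 - 2 * s)) ≤ Real.exp (2 * s ^ 2) := by
  rw [abs_le] at hs
  obtain ⟨h1, h2⟩ := hs
  have hpos : 0 < 1 - 2 * s := by linarith
  have key : 1 ≤ (1 - 2 * s) * Real.exp (2 * s + 4 * s ^ 2) := by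
    rcases le_total 0 s with h | h
    · have := Real.quadratic_le_exp_of_nonneg (x := 2 * s + 4 * s ^ 2) (by positivity)
      refine le_trans ?_ (mul_le_mul_of_nonneg_left this hpos.le)
      have h3 : 0 ≤ s ^ 2 * (1 - 4 * s) := mul_nonneg (by positivity) (by linarith)
      have h4 : 0 ≤ s ^ 3 * (1 - 4 * s) := mul_nonneg (by positivity) (by linarith)
      have h5 : 0 ≤ s ^ 4 * (1 - 4 * s) := mul_nonneg (by positivity) (by linarith)
      have h6 : 0 ≤ s ^ 2 := by positivity
      have h7 : 0 ≤ s ^ 3 := by positivity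
      nlinarith
    · have := Real.add_one_le_exp (2 * s + 4 * s ^ 2)
      refine le_trans ?_ (mul_le_mul_of_nonneg_left this hpos.le)
      have : 0 ≤ (-s) ^ 3 := by
        have : 0 ≤ -s := by linarith
        positivity
      nlinarith
  have h2 : Real.sqrt (1 / (1 - 2 * s)) ≤ Real.exp (s + 2 * s ^ 2) := by
    rw [Real.sqrt_le_left (by positivity), ← Real.exp_nat_mul, div_le_iff₀ hpos]
    refine key.trans (le_of_eq ?_)
    rw [mul_comm]; congr 2; push_cast; ring
  calc _ ≤ Real.exp (-s) * Real.exp (s + 2 * s ^ 2) := by gcongr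
    _ = _ := by rw [← Real.exp_add]; congr 1; ring

lemma pdf_aux (d : ℕ) (hd : 0 < d) (s x : ℝ) :
    gaussianPDFReal 0 (d : NNReal)⁻¹ x * Real.exp (s * (d * x ^ 2 - 1)) =
      ((Real.sqrt (2 * Real.pi / d))⁻¹ * Real.exp (-s)) * Real.exp (-(d * (1 - 2 * s) / 2) * x ^ 2) := by
  have hd' : (d : ℝ) ≠ 0 := by positivity
  rw [gaussianPDFReal, mul_assoc _ (Real.exp _), mul_assoc _ (Real.exp (-s)), ← Real.exp_add,
    ← Real.exp_add]
  simp only [NNReal.coe_inv, NNReal.coe_natCast, ← div_eq_mul_inv]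
  congr 2
  field_simp
  ring

lemma one_dim (d : ℕ) (hd : 0 < d) (s : ℝ) (hs : |s| ≤ 1/4) :
    Integrable (fun x : ℝ => Real.exp (s * (d * x ^ 2 - 1))) (gaussianReal 0 (d : NNReal)⁻¹) ∧
    ∫ x, Real.exp (s * (d * x ^ 2 - 1)) ∂(gaussianReal 0 (d : NNReal)⁻¹) ≤ Real.exp (2 * s ^ 2) := by
  have hv : (d : NNReal)⁻¹ ≠ 0 := by positivity
  have hd' : (0:ℝ) < d := by positivity
  have h1 : 0 < 1 - 2 * s := by rw [abs_le] at hs; linarith [hs.2]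
  constructor
  · rw [gaussianReal_of_var_ne_zero _ hv]
    rw [integrable_withDensity_iff_integrable_smul' (measurable_gaussianPDF _ _)
      (ae_of_all _ fun x => gaussianPDF_lt_top)]
    simp only [toReal_gaussianPDF, smul_eq_mul, pdf_aux d hd]
    exact (integrable_exp_neg_mul_sq (by positivity)).const_mul _
  · rw [integral_gaussianReal_eq_integral_smul hv]
    simp only [smul_eq_mul, pdf_aux d hd]
    rw [integral_const_mul, integral_gaussian]
    refine le_trans (le_of_eq ?_) (exp_aux s hs)
    rw [mul_comm (Real.sqrt (2 * Real.pi / d))⁻¹, mul_assoc, ← Real.sqrt_inv, ← Real.sqrt_mul (by positivity)]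
    congr 2
    have := Real.pi_pos
    field_simp

lemma rpow_le_exp (p : ℝ) (hp : 1 ≤ p) :
    ∃ C : ℝ, 0 < C ∧ ∀ y : ℝ, |y| ^ p ≤ C * (Real.exp y + Real.exp (-y)) := by
  refine ⟨1 + (⌈p⌉₊).factorial, by positivity, fun y => ?_⟩
  have h1 : |y| ^ p ≤ 1 + |y| ^ ⌈p⌉₊ := by
    rcases le_total |y| 1 with h | h
    · have := Real.rpow_le_one (abs_nonneg y) h (by linarith : 0 ≤ p)
      have : 0 ≤ |y| ^ ⌈p⌉₊ := by positivity
      linarith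
    · have := Real.rpow_le_rpow_of_exponent_le h (Nat.le_ceil p)
      rw [Real.rpow_natCast] at this
      linarith
  have h2 := Real.pow_div_factorial_le_exp |y| (abs_nonneg y) ⌈p⌉₊
  rw [div_le_iff₀ (by positivity)] at h2
  have h3 : Real.exp |y| ≤ Real.exp y + Real.exp (-y) := by
    rcases abs_cases y with h | h <;> rw [h.1] <;> linarith [Real.exp_pos y, Real.exp_pos (-y)]
  have h4 : 1 ≤ Real.exp |y| := Real.one_le_exp (abs_nonneg y)
  calc |y| ^ p ≤ (1 + (⌈p⌉₊).factorial) * Real.exp |y| := by linarith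
    _ ≤ _ := by gcongr

lemma rot (d : ℕ) (b : OrthonormalBasis (Fin d) ℝ (EuclideanSpace ℝ (Fin d))) :
    (stdGaussianVec d).map (fun x => WithLp.ofLp (b.repr (WithLp.toLp 2 x))) = stdGaussianVec d := by
  have hc : ∀ t, charFun ((stdGaussianVec d).map (WithLp.toLp 2)) t =
      Complex.exp (-((d : ℝ)⁻¹ * ‖t‖ ^ 2 / 2 : ℝ)) := by
    intro t
    simp_rw [stdGaussianVec, charFun_pi, charFun_gaussianReal, ← Complex.exp_sum,
      EuclideanSpace.real_norm_sq_eq]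
    congr 1
    simp [Finset.sum_div, Finset.mul_sum]
  have h : ((stdGaussianVec d).map (WithLp.toLp 2)).map b.repr = (stdGaussianVec d).map (WithLp.toLp 2) := by
    have : IsFiniteMeasure (stdGaussianVec d) := by unfold stdGaussianVec; infer_instance
    apply Measure.ext_of_charFun
    ext t
    rw [charFun_apply, integral_map (by fun_prop) (by fun_prop)]
    have : ∀ x, inner ℝ (b.repr x) t = inner ℝ x (b.repr.symm t) := by
      intro x
      rw [← b.repr.inner_map_map x (b.repr.symm t)]; simp
    simp_rw [this]
    rw [← charFun_apply, hc, hc]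
    simp
  have h2 : (fun x => WithLp.ofLp (b.repr (WithLp.toLp 2 x))) =
    (WithLp.ofLp ∘ b.repr) ∘ (WithLp.toLp 2) := rfl
  rw [h2, ← Measure.map_map (by fun_prop) (by fun_prop), ← Measure.map_map (by fun_prop) (by fun_prop), h,
    Measure.map_map (by fun_prop) (by fun_prop)]
  exact Measure.map_id

lemma diag_form {d : ℕ} {A : Matrix (Fin d) (Fin d) ℝ} (hA : A.IsHermitian) (x : Fin d → ℝ) :
    x ⬝ᵥ A *ᵥ x = ∑ i, hA.eigenvalues i * (hA.eigenvectorBasis.repr (WithLp.toLp 2 x) i) ^ 2 := by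
  have h := hA.eigenvectorBasis.sum_inner_mul_inner (WithLp.toLp 2 (A *ᵥ x)) (WithLp.toLp 2 x)
  have h0 : inner ℝ (WithLp.toLp 2 (A *ᵥ x)) (WithLp.toLp 2 x) = x ⬝ᵥ A *ᵥ x := by
    simp [EuclideanSpace.inner_eq_star_dotProduct]
  rw [← h0, ← h]
  refine Finset.sum_congr rfl fun i _ => ?_
  rw [OrthonormalBasis.repr_apply_apply]
  have h1 : inner ℝ (WithLp.toLp 2 (A *ᵥ x)) (hA.eigenvectorBasis i) =
      hA.eigenvalues i * inner ℝ (hA.eigenvectorBasis i) (WithLp.toLp 2 x) := by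
    have hs : Aᵀ = A := (conjTranspose_eq_transpose_of_trivial A).symm.trans hA
    simp only [EuclideanSpace.inner_eq_star_dotProduct, star_trivial]
    rw [dotProduct_mulVec, ← mulVec_transpose, hs, hA.mulVec_eigenvectorBasis]
    simp [dotProduct_comm]
  rw [h1]; ring

lemma eig_bound {d : ℕ} {A : Matrix (Fin d) (Fin d) ℝ} (hA : A.IsHermitian) (K : ℝ)
    (hK : ∀ x, |x ⬝ᵥ A *ᵥ x| ≤ K * (x ⬝ᵥ x)) (i : Fin d) : |hA.eigenvalues i| ≤ K := by
  have h := hK (hA.eigenvectorBasis i)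
  have h1 : (hA.eigenvectorBasis i).ofLp ⬝ᵥ (hA.eigenvectorBasis i).ofLp = 1 := by
    have : inner ℝ (hA.eigenvectorBasis i) (hA.eigenvectorBasis i) = 1 := by
      rw [real_inner_self_eq_norm_sq, hA.eigenvectorBasis.norm_eq_one]; norm_num
    rw [EuclideanSpace.inner_eq_star_dotProduct, star_trivial] at this
    exact this
  rw [hA.mulVec_eigenvectorBasis] at h
  rw [dotProduct_smul, h1] at h
  simpa using h

lemma diag_exp (d : ℕ) (hd : 0 < d) (s : Fin d → ℝ) (hs : ∀ i, |s i| ≤ 1 / (4 * Real.sqrt d)) :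
    ∫⁻ y, ENNReal.ofReal (Real.exp (∑ i, s i * (d * y i ^ 2 - 1))) ∂(stdGaussianVec d) ≤
      ENNReal.ofReal (Real.exp 1) := by
  have hd' : (0:ℝ) < d := by positivity
  have hd1 : 1 ≤ Real.sqrt d := by
    rw [Real.one_le_sqrt]; exact_mod_cast hd
  have hs4 : ∀ i, |s i| ≤ 1 / 4 := fun i => (hs i).trans (by
    apply one_div_le_one_div_of_le <;> linarith)
  have hs2 : ∀ i, 2 * s i ^ 2 ≤ 1 / d := fun i => by
    have h := pow_le_pow_left₀ (abs_nonneg _) (hs i) 2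
    rw [sq_abs, div_pow, mul_pow, Real.sq_sqrt hd'.le] at h
    have : (1:ℝ) ^ 2 / (4 ^ 2 * d) = 1 / 16 * (1 / d) := by field_simp; norm_num
    have h3 : 0 < 1 / (d:ℝ) := by positivity
    linarith
  have hi : Integrable (fun y : Fin d → ℝ => ∏ i, Real.exp (s i * (d * y i ^ 2 - 1)))
      (Measure.pi fun _ : Fin d => gaussianReal 0 (d : NNReal)⁻¹) :=
    Integrable.fintype_prod (f := fun i x => Real.exp (s i * (d * x ^ 2 - 1)))
      fun i => (one_dim d hd (s i) (hs4 i)).1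
  simp_rw [Real.exp_sum]
  rw [stdGaussianVec, ← ofReal_integral_eq_lintegral_ofReal hi
    (ae_of_all _ fun y => by positivity)]
  apply ENNReal.ofReal_le_ofReal
  rw [integral_fintype_prod_eq_prod (f := fun i x => Real.exp (s i * (d * x ^ 2 - 1)))]
  calc _ ≤ ∏ i, Real.exp (2 * s i ^ 2) :=
        Finset.prod_le_prod (fun i _ => integral_nonneg fun x => (Real.exp_pos _).le)
          fun i _ => (one_dim d hd (s i) (hs4 i)).2
    _ = Real.exp (∑ i, 2 * s i ^ 2) := (Real.exp_sum _ _).symm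
    _ ≤ Real.exp 1 := by
        apply Real.exp_le_exp.2
        calc _ ≤ ∑ i : Fin d, 1 / (d : ℝ) := Finset.sum_le_sum fun i _ => hs2 i
          _ = 1 := by simp [hd'.ne']

lemma quad_exp (d : ℕ) (hd : 0 < d) (A : Matrix (Fin d) (Fin d) ℝ) (hA : A.IsHermitian) (K : ℝ)
    (hK : ∀ x, |x ⬝ᵥ A *ᵥ x| ≤ K * (x ⬝ᵥ x)) (c : ℝ) (hc : |c| * K ≤ Real.sqrt d / 4) :
    ∫⁻ x, ENNReal.ofReal (Real.exp (c * (x ⬝ᵥ A *ᵥ x - A.trace / d))) ∂(stdGaussianVec d) ≤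
      ENNReal.ofReal (Real.exp 1) := by
  have hd' : (0:ℝ) < d := by positivity
  have hsq : 0 < Real.sqrt d := Real.sqrt_pos.2 hd'
  refine le_trans (le_of_eq ?_) (diag_exp d hd (fun i => c * hA.eigenvalues i / d) fun i => ?_)
  · conv_rhs => rw [← rot d hA.eigenvectorBasis]
    rw [lintegral_map (by fun_prop) (by fun_prop)]
    refine lintegral_congr fun x => ?_
    congr 2
    rw [diag_form hA, hA.trace_eq_sum_eigenvalues, Finset.sum_div, ← Finset.sum_sub_distrib,
      Finset.mul_sum]
    refine Finset.sum_congr rfl fun i _ => ?_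
    simp only [RCLike.ofReal_real_eq_id, id]
    field_simp
  · have h := eig_bound hA K hK i
    rw [abs_div, abs_mul, abs_of_pos hd', div_le_div_iff₀ hd' (by positivity)]
    have h2 : |c| * |hA.eigenvalues i| ≤ Real.sqrt d / 4 :=
      (mul_le_mul_of_nonneg_left h (abs_nonneg c)).trans hc
    have h3 := Real.mul_self_sqrt hd'.le
    nlinarith

lemma quad (p : ℝ) (hp : 1 ≤ p) : ∃ C : ℝ, 0 < C ∧ ∀ d : ℕ, 0 < d →
    ∀ A : Matrix (Fin d) (Fin d) ℝ, A.IsHermitian → ∀ K : ℝ, 0 ≤ K →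
    (∀ x, |x ⬝ᵥ A *ᵥ x| ≤ K * (x ⬝ᵥ x)) →
    ∫⁻ x, ENNReal.ofReal (|x ⬝ᵥ A *ᵥ x - A.trace / d| ^ p) ∂(stdGaussianVec d) ≤
      ENNReal.ofReal (C * (K / Real.sqrt d) ^ p) := by
  obtain ⟨C, hC, h⟩ := rpow_le_exp p hp
  refine ⟨4 ^ p * (C * (Real.exp 1 + Real.exp 1)), by positivity, ?_⟩
  intro d hd A hA K hK0 hK
  have hd' : (0:ℝ) < d := by positivity
  have hsq : 0 < Real.sqrt d := Real.sqrt_pos.2 hd'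
  rcases hK0.eq_or_lt with rfl | hKpos
  · have h0 : ∀ x, x ⬝ᵥ A *ᵥ x = 0 := fun x => by
      have := hK x; rw [zero_mul] at this; exact abs_nonpos_iff.1 this
    have ht : A.trace = 0 := by
      rw [trace]
      refine Finset.sum_eq_zero fun i _ => ?_
      have := h0 (Pi.single i 1)
      simpa using this
    simp [h0, ht, Real.zero_rpow (by linarith : p ≠ 0)]
  · set t := Real.sqrt d / (4 * K) with ht
    have htpos : 0 < t := by positivity
    have htK : t * K = Real.sqrt d / 4 := by rw [ht]; field_simp
    have hpt : ∀ x : Fin d → ℝ, ENNReal.ofReal (|x ⬝ᵥ A *ᵥ x - A.trace / d| ^ p) ≤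
        ENNReal.ofReal (t⁻¹ ^ p * C) *
        (ENNReal.ofReal (Real.exp (t * (x ⬝ᵥ A *ᵥ x - A.trace / d))) +
          ENNReal.ofReal (Real.exp ((-t) * (x ⬝ᵥ A *ᵥ x - A.trace / d)))) := by
      intro x
      rw [← ENNReal.ofReal_add (by positivity) (by positivity), ← ENNReal.ofReal_mul (by positivity)]
      apply ENNReal.ofReal_le_ofReal
      set X := x ⬝ᵥ A *ᵥ x - A.trace / d
      have h1 := h (t * X)
      rw [← neg_mul] at h1
      have h2 : |X| ^ p = t⁻¹ ^ p * |t * X| ^ p := by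
        rw [← Real.mul_rpow (by positivity) (by positivity), abs_mul, abs_of_pos htpos]
        field_simp
      rw [h2, mul_assoc]
      gcongr
    refine (lintegral_mono hpt).trans ?_
    rw [lintegral_const_mul _ (by fun_prop), lintegral_add_left (by fun_prop)]
    have e1 := quad_exp d hd A hA K hK t (by rw [abs_of_pos htpos, htK])
    have e2 := quad_exp d hd A hA K hK (-t) (by rw [abs_neg, abs_of_pos htpos, htK])
    refine (mul_le_mul_right (add_le_add e1 e2) _).trans (le_of_eq ?_)
    rw [← ENNReal.ofReal_add (by positivity) (by positivity), ← ENNReal.ofReal_mul (by positivity)]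
    congr 1
    have : t⁻¹ = 4 * (K / Real.sqrt d) := by rw [ht]; field_simp
    rw [this, Real.mul_rpow (by positivity) (by positivity)]
    ring

lemma norm_moment (p : ℝ) (hp : 1 ≤ p) : ∃ C : ℝ, 0 < C ∧ ∀ d : ℕ, 0 < d →
    ∫⁻ x, ENNReal.ofReal ((x ⬝ᵥ x) ^ p) ∂(stdGaussianVec d) ≤ ENNReal.ofReal C := by
  obtain ⟨C, hC, h⟩ := quad p hp
  refine ⟨2 ^ (p - 1) * (C + 1), by positivity, fun d hd => ?_⟩
  have : IsProbabilityMeasure (stdGaussianVec d) := by unfold stdGaussianVec; infer_instance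
  have hd' : (0:ℝ) < d := by positivity
  have hd1 : 1 ≤ Real.sqrt d := by
    rw [Real.one_le_sqrt]; exact_mod_cast hd
  have h1 := h d hd 1 isHermitian_one 1 zero_le_one (fun x => by
    simp only [one_mulVec, one_mul]
    rw [abs_of_nonneg (by simpa using dotProduct_star_self_nonneg x)])
  simp only [one_mulVec, trace_one, Fintype.card_fin, div_self hd'.ne'] at h1
  have hpt : ∀ x : Fin d → ℝ, ENNReal.ofReal ((x ⬝ᵥ x) ^ p) ≤
      ENNReal.ofReal (2 ^ (p - 1)) * (ENNReal.ofReal (|x ⬝ᵥ x - 1| ^ p) + 1) := by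
    intro x
    rw [← ENNReal.ofReal_one, ← ENNReal.ofReal_add (by positivity) (by positivity),
      ← ENNReal.ofReal_mul (by positivity)]
    apply ENNReal.ofReal_le_ofReal
    have h0 : 0 ≤ x ⬝ᵥ x := by simpa using dotProduct_star_self_nonneg x
    have h2 := add_rpow_aux (abs_nonneg (x ⬝ᵥ x - 1)) zero_le_one hp
    rw [Real.one_rpow] at h2
    refine le_trans ?_ h2
    apply Real.rpow_le_rpow h0 _ (by linarith)
    linarith [le_abs_self (x ⬝ᵥ x - 1)]
  refine (lintegral_mono hpt).trans ?_
  rw [lintegral_const_mul' _ _ ENNReal.ofReal_ne_top, lintegral_add_right _ measurable_const,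
    ENNReal.ofReal_mul (by positivity), ENNReal.ofReal_add hC.le zero_le_one]
  gcongr
  · refine h1.trans (ENNReal.ofReal_le_ofReal ?_)
    have : (1 / Real.sqrt d) ^ p ≤ 1 :=
      Real.rpow_le_one (by positivity) ((div_le_one (by positivity)).2 hd1) (by linarith)
    nlinarith
  · simp

/-- The Frobenius inner product as a bilinear map. -/
def finnerL (d : ℕ) : Matrix (Fin d) (Fin d) ℝ →ₗ[ℝ] Matrix (Fin d) (Fin d) ℝ →ₗ[ℝ] ℝ :=
  LinearMap.mk₂ ℝ finner
    (fun A B C => by simp [finner, add_mul, Finset.sum_add_distrib])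
    (fun c A B => by simp [finner, mul_assoc, Finset.mul_sum])
    (fun A B C => by simp [finner, mul_add, Finset.sum_add_distrib])
    (fun c A B => by simp [finner, mul_left_comm, Finset.mul_sum])

lemma finnerL_apply {d : ℕ} (A B : Matrix (Fin d) (Fin d) ℝ) : finnerL d A B = finner A B := rfl

lemma finner_comm' {d : ℕ} (A B : Matrix (Fin d) (Fin d) ℝ) : finner A B = finner B A := by
  simp [finner, mul_comm]

lemma vec_left {d : ℕ} (x v : Fin d → ℝ) :
    vecMulVec x v = ∑ a, x a • vecMulVec (Pi.single a 1) v := by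
  ext i j
  simp [Matrix.sum_apply, vecMulVec_apply, Pi.single_apply]

lemma vec_right {d : ℕ} (x v : Fin d → ℝ) :
    vecMulVec x v = ∑ a, v a • vecMulVec x (Pi.single a 1) := by
  ext i j
  simp [Matrix.sum_apply, vecMulVec_apply, Pi.single_apply, mul_comm]

lemma finner_vec {d : ℕ} (x v : Fin d → ℝ) :
    finner (vecMulVec x v) (vecMulVec x v) = (v ⬝ᵥ v) * (x ⬝ᵥ x) := by
  simp only [finner, vecMulVec_apply, dotProduct]
  rw [mul_comm, Finset.sum_mul_sum]
  refine Finset.sum_congr rfl fun i _ => Finset.sum_congr rfl fun j _ => by ring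

lemma finner_self_nonneg {d : ℕ} (A : Matrix (Fin d) (Fin d) ℝ) : 0 ≤ finner A A :=
  Finset.sum_nonneg fun _ _ => Finset.sum_nonneg fun _ _ => mul_self_nonneg _

lemma finner_cs {d : ℕ} (A B : Matrix (Fin d) (Fin d) ℝ) :
    |finner A B| ≤ Real.sqrt (finner A A) * Real.sqrt (finner B B) := by
  rw [← Real.sqrt_mul (finner_self_nonneg A)]
  apply Real.abs_le_sqrt
  simp only [finner, ← Fintype.sum_prod_type', ← sq]
  exact Finset.sum_mul_sq_le_sq_mul_sq _ _ _

section

variable {d : ℕ} (T : Matrix (Fin d) (Fin d) ℝ →ₗ[ℝ] Matrix (Fin d) (Fin d) ℝ)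

/-- The matrix of the quadratic form in `u` for fixed `v`. -/
def Mmat (v : Fin d → ℝ) : Matrix (Fin d) (Fin d) ℝ :=
  of fun a c => finner (vecMulVec (Pi.single a 1) v) (T (vecMulVec (Pi.single c 1) v))

/-- The partial trace. -/
def Nmat : Matrix (Fin d) (Fin d) ℝ :=
  of fun b e => ∑ a, finner (vecMulVec (Pi.single a 1) (Pi.single b 1))
    (T (vecMulVec (Pi.single a 1) (Pi.single e 1)))

lemma Mmat_form (v x : Fin d → ℝ) :
    x ⬝ᵥ Mmat T v *ᵥ x = finner (vecMulVec x v) (T (vecMulVec x v)) := by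
  conv_rhs => rw [vec_left x v, ← finnerL_apply]
  simp only [map_sum, map_smul, LinearMap.sum_apply, LinearMap.smul_apply, finnerL_apply]
  simp only [dotProduct, mulVec, Mmat, of_apply, Finset.mul_sum, smul_eq_mul]
  rw [Finset.sum_comm]
  refine Finset.sum_congr rfl fun i _ => Finset.sum_congr rfl fun j _ => by ring

lemma Nmat_form (v : Fin d → ℝ) : v ⬝ᵥ Nmat T *ᵥ v = (Mmat T v).trace := by
  have : ∀ a : Fin d, finner (vecMulVec (Pi.single a 1) v) (T (vecMulVec (Pi.single a 1) v)) =
      ∑ b, ∑ e, v b * (finner (vecMulVec (Pi.single a 1) (Pi.single b 1))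
    (T (vecMulVec (Pi.single a 1) (Pi.single e 1))) * v e) := by
    intro a
    conv_lhs => rw [vec_right _ v, ← finnerL_apply]
    simp only [map_sum, map_smul, LinearMap.sum_apply, LinearMap.smul_apply, finnerL_apply]
    simp only [Finset.mul_sum, smul_eq_mul]
    rw [Finset.sum_comm]
    refine Finset.sum_congr rfl fun i _ => Finset.sum_congr rfl fun j _ => by ring
  simp only [trace, diag_apply, Mmat, of_apply, this]
  simp only [dotProduct, mulVec, Nmat, of_apply, Finset.mul_sum, Finset.sum_mul]
  rw [Finset.sum_comm' (t' := Finset.univ) (s' := fun _ => Finset.univ) (by simp)]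
  conv_rhs => rw [Finset.sum_comm]; enter [2, b]; rw [Finset.sum_comm]
  rw [Finset.sum_comm]

lemma Nmat_trace : (Nmat T).trace = LinearMap.trace ℝ _ T := by
  rw [LinearMap.trace_eq_matrix_trace ℝ (Matrix.stdBasis ℝ (Fin d) (Fin d))]
  simp only [trace, diag_apply, Nmat, of_apply, LinearMap.toMatrix_apply, Fintype.sum_prod_type]
  rw [Finset.sum_comm]
  refine Finset.sum_congr rfl fun i _ => Finset.sum_congr rfl fun j _ => ?_
  have h : ∀ X : Matrix (Fin d) (Fin d) ℝ, (Matrix.stdBasis ℝ (Fin d) (Fin d)).repr X (i, j) = X i j :=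
    fun X => by simp [Matrix.stdBasis]
  rw [h, Matrix.stdBasis_eq_single, ← Matrix.single_eq_single_vecMulVec_single]
  simp [finner, Matrix.single_apply, ite_and]

lemma Mmat_herm (hT : ∀ A B, finner (T A) B = finner A (T B)) (v : Fin d → ℝ) :
    (Mmat T v).IsHermitian := by
  ext i j
  simp only [conjTranspose_apply, Mmat, of_apply, star_trivial]
  rw [← hT, finner_comm']

lemma Nmat_herm (hT : ∀ A B, finner (T A) B = finner A (T B)) : (Nmat T).IsHermitian := by
  ext i j
  simp only [conjTranspose_apply, Nmat, of_apply, star_trivial]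
  refine Finset.sum_congr rfl fun a _ => ?_
  rw [← hT, finner_comm']

lemma T_form_bound (K : ℝ)
    (hK : ∀ A, Real.sqrt (finner (T A) (T A)) ≤ K * Real.sqrt (finner A A))
    (A : Matrix (Fin d) (Fin d) ℝ) : |finner A (T A)| ≤ K * finner A A := by
  refine (finner_cs A (T A)).trans ?_
  have h := mul_le_mul_of_nonneg_left (hK A) (Real.sqrt_nonneg (finner A A))
  have h2 := Real.mul_self_sqrt (finner_self_nonneg A)
  calc _ ≤ _ := h
    _ = K * (Real.sqrt (finner A A) * Real.sqrt (finner A A)) := by ring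
    _ = _ := by rw [h2]

lemma Mmat_bound (K : ℝ)
    (hK : ∀ A, Real.sqrt (finner (T A) (T A)) ≤ K * Real.sqrt (finner A A)) (v x : Fin d → ℝ) :
    |x ⬝ᵥ Mmat T v *ᵥ x| ≤ (K * (v ⬝ᵥ v)) * (x ⬝ᵥ x) := by
  rw [Mmat_form, mul_assoc, ← finner_vec]
  exact T_form_bound T K hK _

lemma Nmat_bound (K : ℝ)
    (hK : ∀ A, Real.sqrt (finner (T A) (T A)) ≤ K * Real.sqrt (finner A A)) (v : Fin d → ℝ) :
    |v ⬝ᵥ Nmat T *ᵥ v| ≤ (K * d) * (v ⬝ᵥ v) := by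
  rw [Nmat_form, trace]
  refine (Finset.abs_sum_le_sum_abs _ _).trans ?_
  calc _ ≤ ∑ i : Fin d, K * (v ⬝ᵥ v) := Finset.sum_le_sum fun i _ => by
        refine (T_form_bound T K hK _).trans (le_of_eq ?_)
        rw [finner_vec]; simp
    _ = _ := by simp; ring

lemma K_nonneg (hd : 0 < d) (K : ℝ)
    (hK : ∀ A, Real.sqrt (finner (T A) (T A)) ≤ K * Real.sqrt (finner A A)) : 0 ≤ K := by
  have h := (Real.sqrt_nonneg _).trans
    (hK (vecMulVec (Pi.single ⟨0, hd⟩ 1) (Pi.single ⟨0, hd⟩ 1)))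
  rw [finner_vec] at h
  simpa using h

end

/-- **Fresh rank-one trace estimate.** Let `u, v ∼ N(0, I_d/d)` be independent and let
`T` be a self-adjoint linear operator on `d×d` matrices (w.r.t. the Frobenius inner
product). For every `p ∈ [1,∞)` there is a constant `C_p`, independent of `d` and `T`,
such that `E[ |⟨uvᵀ, T[uvᵀ]⟩_F − tr(T)/d²|^p ]^{1/p} ≤ C_p ‖T‖_op / √d`, the operator
norm being taken w.r.t. the Frobenius norm (formalized by quantifying over Lipschitz
bounds `K` for `T`). -/
theorem fresh_rank_one_trace_estimate (p : ℝ) (hp : 1 ≤ p) :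
    ∃ C : ℝ, 0 < C ∧ ∀ d : ℕ, 0 < d →
      ∀ T : Matrix (Fin d) (Fin d) ℝ →ₗ[ℝ] Matrix (Fin d) (Fin d) ℝ,
      (∀ A B, finner (T A) B = finner A (T B)) →
      ∀ K : ℝ,
      (∀ A, Real.sqrt (finner (T A) (T A)) ≤ K * Real.sqrt (finner A A)) →
      (∫ q : (Fin d → ℝ) × (Fin d → ℝ),
          |finner (vecMulVec q.1 q.2) (T (vecMulVec q.1 q.2)) -
            LinearMap.trace ℝ (Matrix (Fin d) (Fin d) ℝ) T / (d : ℝ) ^ 2| ^ p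
          ∂(stdGaussianVec d).prod (stdGaussianVec d)) ^ (1 / p) ≤
        C * K / Real.sqrt d := by
  obtain ⟨C, hC, hQ⟩ := quad p hp
  obtain ⟨D, hD, hN⟩ := norm_moment p hp
  refine ⟨(2 ^ (p - 1) * (C * D + C)) ^ (1 / p), by positivity, ?_⟩
  intro d hd T hT K hK
  have hK0 := K_nonneg T hd K hK
  have hprob : IsProbabilityMeasure (stdGaussianVec d) := by unfold stdGaussianVec; infer_instance
  have hd' : (0:ℝ) < d := by positivity
  have hsq : 0 < Real.sqrt d := Real.sqrt_pos.2 hd'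
  have hTc : Continuous T := LinearMap.continuous_of_finiteDimensional T
  have hvc : Continuous fun q : (Fin d → ℝ) × (Fin d → ℝ) => vecMulVec q.1 q.2 := by
    refine continuous_matrix fun i j => ?_
    simp only [vecMulVec_apply]; fun_prop
  have hFc : Continuous fun q : (Fin d → ℝ) × (Fin d → ℝ) =>
      finner (vecMulVec q.1 q.2) (T (vecMulVec q.1 q.2)) := by
    unfold finner
    refine continuous_finsetSum _ fun a _ => continuous_finsetSum _ fun b _ => ?_
    exact (hvc.matrix_elem a b).mul ((hTc.comp hvc).matrix_elem a b)
  set τ := LinearMap.trace ℝ (Matrix (Fin d) (Fin d) ℝ) T with hτ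
  have hX2c : Continuous fun v : Fin d → ℝ => (Mmat T v).trace := by
    simp only [← Nmat_form, dotProduct, mulVec]; fun_prop
  -- the two pieces
  set X1 : (Fin d → ℝ) × (Fin d → ℝ) → ℝ := fun q =>
    finner (vecMulVec q.1 q.2) (T (vecMulVec q.1 q.2)) - (Mmat T q.2).trace / d with hX1
  set X2 : (Fin d → ℝ) → ℝ := fun v => (Mmat T v).trace / d - τ / (d : ℝ) ^ 2 with hX2
  have hX1c : Continuous X1 := hFc.sub ((hX2c.comp continuous_snd).div_const _)
  have hX2c' : Continuous X2 := (hX2c.div_const _).sub continuous_const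
  have hm1 : Measurable fun q => ENNReal.ofReal (|X1 q| ^ p) := by
    have := hX1c.measurable; fun_prop
  have hm2 : Measurable fun v => ENNReal.ofReal (|X2 v| ^ p) := by
    have := hX2c'.measurable; fun_prop
  have hpt : ∀ q : (Fin d → ℝ) × (Fin d → ℝ),
      ENNReal.ofReal (|finner (vecMulVec q.1 q.2) (T (vecMulVec q.1 q.2)) - τ / (d : ℝ) ^ 2| ^ p) ≤
      ENNReal.ofReal (2 ^ (p - 1)) * (ENNReal.ofReal (|X1 q| ^ p) + ENNReal.ofReal (|X2 q.2| ^ p)) := by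
    intro q
    rw [← ENNReal.ofReal_add (by positivity) (by positivity), ← ENNReal.ofReal_mul (by positivity)]
    apply ENNReal.ofReal_le_ofReal
    refine le_trans ?_ (add_rpow_aux (abs_nonneg (X1 q)) (abs_nonneg (X2 q.2)) hp)
    apply Real.rpow_le_rpow (abs_nonneg _) _ (by linarith)
    refine le_trans (le_of_eq ?_) (abs_add_le _ _)
    simp [hX1, hX2]
  have hB1 : ∫⁻ q, ENNReal.ofReal (|X1 q| ^ p) ∂(stdGaussianVec d).prod (stdGaussianVec d) ≤
      ENNReal.ofReal (C * D * (K / Real.sqrt d) ^ p) := by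
    rw [lintegral_prod_symm' _ hm1]
    calc _ ≤ ∫⁻ v, ENNReal.ofReal (C * (K / Real.sqrt d) ^ p) * ENNReal.ofReal ((v ⬝ᵥ v) ^ p)
            ∂(stdGaussianVec d) := by
          refine lintegral_mono fun v => ?_
          have hv : 0 ≤ v ⬝ᵥ v := by simpa using dotProduct_star_self_nonneg v
          have h := hQ d hd (Mmat T v) (Mmat_herm T hT v) (K * (v ⬝ᵥ v)) (by positivity)
            (Mmat_bound T K hK v)
          simp only [Mmat_form] at h
          refine h.trans (le_of_eq ?_)
          rw [← ENNReal.ofReal_mul (by positivity), mul_assoc,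
            ← Real.mul_rpow (by positivity) hv]
          congr 3; ring
      _ ≤ _ := by
          rw [lintegral_const_mul' _ _ ENNReal.ofReal_ne_top]
          refine (mul_le_mul_right (hN d hd) _).trans (le_of_eq ?_)
          rw [← ENNReal.ofReal_mul (by positivity)]
          congr 1; ring
  have hB2 : ∫⁻ q, ENNReal.ofReal (|X2 q.2| ^ p) ∂(stdGaussianVec d).prod (stdGaussianVec d) ≤
      ENNReal.ofReal (C * (K / Real.sqrt d) ^ p) := by
    have hm3 : Measurable fun q : (Fin d → ℝ) × (Fin d → ℝ) => ENNReal.ofReal (|X2 q.2| ^ p) :=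
      hm2.comp measurable_snd
    rw [lintegral_prod_symm' _ hm3]
    simp only [lintegral_const, measure_univ, mul_one]
    have h := hQ d hd ((d : ℝ)⁻¹ • Nmat T) (by
        have := Nmat_herm T hT
        ext i j
        have h2 := congrFun (congrFun this i) j
        simp only [conjTranspose_apply, star_trivial, Matrix.smul_apply] at h2 ⊢
        rw [h2]) K hK0 (fun v => by
        rw [smul_mulVec, dotProduct_smul, smul_eq_mul, abs_mul, abs_of_pos (inv_pos.2 hd')]
        have := mul_le_mul_of_nonneg_left (Nmat_bound T K hK v) (inv_pos.2 hd').le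
        refine this.trans (le_of_eq ?_)
        field_simp)
    refine le_trans (le_of_eq (lintegral_congr fun v => ?_)) h
    rw [smul_mulVec, dotProduct_smul, Nmat_form, trace_smul, Nmat_trace, ← hτ]
    congr 3
    simp only [hX2, smul_eq_mul]
    field_simp
  have hfin : ∫ q : (Fin d → ℝ) × (Fin d → ℝ),
          |finner (vecMulVec q.1 q.2) (T (vecMulVec q.1 q.2)) - τ / (d : ℝ) ^ 2| ^ p
          ∂(stdGaussianVec d).prod (stdGaussianVec d) ≤
      2 ^ (p - 1) * (C * D + C) * (K / Real.sqrt d) ^ p := by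
    rw [integral_eq_lintegral_of_nonneg_ae (ae_of_all _ fun q => by positivity)
      (by have := hFc.measurable
          exact (by fun_prop : Measurable _).aestronglyMeasurable)]
    apply ENNReal.toReal_le_of_le_ofReal (by positivity)
    refine (lintegral_mono hpt).trans ?_
    rw [lintegral_const_mul' _ _ ENNReal.ofReal_ne_top, lintegral_add_left hm1]
    refine (mul_le_mul_right (add_le_add hB1 hB2) _).trans (le_of_eq ?_)
    rw [← ENNReal.ofReal_add (by positivity) (by positivity), ← ENNReal.ofReal_mul (by positivity)]
    congr 1; ring
  calc _ ≤ (2 ^ (p - 1) * (C * D + C) * (K / Real.sqrt d) ^ p) ^ (1 / p) :=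
        Real.rpow_le_rpow (integral_nonneg fun q => by positivity) hfin (by positivity)
    _ = _ := by
        rw [Real.mul_rpow (by positivity) (by positivity), ← Real.rpow_mul (by positivity),
          mul_one_div_cancel (by linarith), Real.rpow_one, mul_div_assoc]

end
end

section
/- Fix α > 0, r ∈ (0,1), β > 0, and λ > 0. Then: (i) for every ν > 0, the function χ ↦ P_{α,r,λ}(ν,χ) on (0,∞) attains its supremum at a unique point χ(ν) ∈ (0,∞); and (ii) the reduced potential V_{α,r,λ}(ν) = sup_{χ>0} P_{α,r,λ}(ν,χ) is λ-strongly convex on (0,∞), i.e., ν ↦ V_{α,r,λ}(ν) − (λ/2)ν² is convex. -/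
open MeasureTheory ProbabilityTheory

noncomputable section

/-- The logistic loss `ℓ(t) = log(1 + e^{-t})`. -/
def logisticLoss (t : ℝ) : ℝ := Real.log (1 + Real.exp (-t))

/-- The softplus `φ_β(t) = β⁻¹ log(1 + e^{β t})`. -/
def softplus (β t : ℝ) : ℝ := Real.log (1 + Real.exp (β * t)) / β

/-- The scalar TAM functional `c_r(ν) = min_μ { μ + (1/r)·E[φ_β(νZ − μ)] }`,
`Z` standard normal. -/
def scalarTAM (r β ν : ℝ) : ℝ :=
  ⨅ μ : ℝ, (μ + (1 / r) * ∫ z, softplus β (ν * z - μ) ∂gaussianReal 0 1)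

/-- The scalar Moreau envelope
`M_r(ν,χ) = E[ min_s ( (s − νG)²/(2χ) + ℓ(s − c_r(ν)) ) ]`, `G` standard normal. -/
def scalarMoreau (r β ν χ : ℝ) : ℝ :=
  ∫ g, (⨅ s : ℝ, ((s - ν * g) ^ 2 / (2 * χ) + logisticLoss (s - scalarTAM r β ν)))
    ∂gaussianReal 0 1

/-- The scalar saddle potential `P_{α,r,λ}(ν,χ) = (λ/2)ν² − ν²/(2αχ) + M_r(ν,χ)`. -/
def saddlePotential (α r β lam ν χ : ℝ) : ℝ :=
  lam / 2 * ν ^ 2 - ν ^ 2 / (2 * α * χ) + scalarMoreau r β ν χ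

/-- The reduced potential `V_{α,r,λ}(ν) = sup_{χ>0} P_{α,r,λ}(ν,χ)`. -/
def reducedPotential (α r β lam ν : ℝ) : ℝ :=
  ⨆ χ : {x : ℝ // 0 < x}, saddlePotential α r β lam ν χ

lemma ll_nonneg (t : ℝ) : 0 ≤ logisticLoss t :=
  Real.log_nonneg (by linarith [Real.exp_pos (-t)])

lemma ll_cont : Continuous logisticLoss := by
  unfold logisticLoss
  refine Continuous.log (by fun_prop) (fun x => ?_)
  positivity

lemma ll_anti {a b : ℝ} (h : a ≤ b) : logisticLoss b ≤ logisticLoss a := by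
  unfold logisticLoss
  apply Real.log_le_log (by positivity)
  gcongr

lemma ll_tangent (y y0 : ℝ) :
    logisticLoss y0 - (y - y0) / (1 + Real.exp y0) ≤ logisticLoss y := by
  unfold logisticLoss
  have hE := Real.exp_pos y0
  set p : ℝ := 1 / (1 + Real.exp y0) with hp
  have hp0 : 0 ≤ p := by positivity
  have hp1 : p ≤ 1 := by rw [hp, div_le_one (by positivity)]; linarith
  have h := Real.geom_mean_le_arith_mean2_weighted (w₁ := 1 - p) (w₂ := p) (p₁ := 1)
    (p₂ := Real.exp (-(y - y0))) (by linarith) hp0 zero_le_one (Real.exp_pos _).le (by ring)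
  rw [Real.one_rpow, one_mul, ← Real.exp_mul] at h
  have h2 : 1 + Real.exp (-y) = (1 + Real.exp (-y0)) * ((1 - p) * 1 + p * Real.exp (-(y - y0))) := by
    have e1 : Real.exp (-(y - y0)) = Real.exp (-y) * Real.exp y0 := by
      rw [← Real.exp_add]; ring_nf
    rw [e1, Real.exp_neg y0, hp]
    field_simp
    ring
  have h3 := Real.log_le_log (Real.exp_pos _) h
  rw [Real.log_exp] at h3
  rw [h2, Real.log_mul (by positivity) (by
    have := (Real.exp_pos (-(y - y0) * p)).trans_le h
    exact this.ne')]
  have : (y - y0) / (1 + Real.exp y0) = (y - y0) * p := by rw [hp]; ring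
  rw [this]
  linarith

lemma ll_convex (a b x y : ℝ) (ha : 0 ≤ a) (hb : 0 ≤ b) (hab : a + b = 1) :
    logisticLoss (a * x + b * y) ≤ a * logisticLoss x + b * logisticLoss y := by
  have h1 := mul_le_mul_of_nonneg_left (ll_tangent x (a * x + b * y)) ha
  have h2 := mul_le_mul_of_nonneg_left (ll_tangent y (a * x + b * y)) hb
  set z := a * x + b * y with hz
  have : a * ((x - z) / (1 + Real.exp z)) + b * ((y - z) / (1 + Real.exp z)) = 0 := by
    rw [← mul_div_assoc, ← mul_div_assoc, ← add_div]
    have : a * (x - z) + b * (y - z) = 0 := by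
      have : a * (x - z) + b * (y - z) = (a * x + b * y) - (a + b) * z := by ring
      rw [this, hab]; linarith
    rw [this, zero_div]
  have h3 : (a + b) * logisticLoss z = logisticLoss z := by rw [hab, one_mul]
  nlinarith

lemma ll_ge (t : ℝ) : -t ≤ logisticLoss t := by
  unfold logisticLoss
  rw [Real.le_log_iff_exp_le (by positivity)]
  linarith

lemma ll_le (t : ℝ) : logisticLoss t ≤ Real.log 2 + |t| := by
  have h := ll_tangent 0 t
  have h0 : logisticLoss 0 = Real.log 2 := by unfold logisticLoss; norm_num
  have hE := Real.exp_pos t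
  have : -((0 - t) / (1 + Real.exp t)) ≥ -|t| := by
    rw [zero_sub, neg_div, neg_neg]
    have := neg_abs_le (t / (1 + Real.exp t))
    have h4 : |t / (1 + Real.exp t)| ≤ |t| := by
      rw [abs_div]
      apply div_le_self (abs_nonneg _)
      rw [abs_of_pos (by positivity)]; linarith
    linarith
  linarith

lemma int_id : Integrable (fun g : ℝ => g) (gaussianReal 0 1) :=
  (memLp_id_gaussianReal (μ := 0) (v := 1) 1).integrable (by norm_num)

lemma int_aff (ν c : ℝ) : Integrable (fun g : ℝ => ν * g - c) (gaussianReal 0 1) :=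
  (int_id.const_mul ν).sub (integrable_const c)

lemma int_mean : ∫ g : ℝ, g ∂(gaussianReal 0 1) = 0 := by
  simpa using integral_id_gaussianReal (μ := 0) (v := 1)

lemma int_ll_of {f : ℝ → ℝ} (hf : Integrable f (gaussianReal 0 1)) :
    Integrable (fun g => logisticLoss (f g)) (gaussianReal 0 1) := by
  refine Integrable.mono' ((integrable_const (Real.log 2)).add hf.abs)
    (ll_cont.comp_aestronglyMeasurable hf.aestronglyMeasurable) ?_
  filter_upwards with g
  rw [Real.norm_of_nonneg (ll_nonneg _)]
  exact ll_le _

lemma prox_exists (χ t : ℝ) (h : 0 < χ) : ∃ d : ℝ, 0 < d ∧ d * (1 + Real.exp (d + t)) = χ := by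
  have hc : ContinuousOn (fun d : ℝ => d * (1 + Real.exp (d + t))) (Set.Icc 0 χ) := by fun_prop
  have := intermediate_value_Icc h.le hc
  obtain ⟨d, hd, hd2⟩ := this (show χ ∈ _ by
    constructor
    · simp [h.le]
    · have := Real.exp_pos (χ + t)
      nlinarith)
  refine ⟨d, lt_of_le_of_ne hd.1 ?_, hd2⟩
  rintro rfl
  simp at hd2
  linarith

open Classical in
/-- The displacement of the proximal point. -/
def proxD (χ t : ℝ) : ℝ := if h : 0 < χ then (prox_exists χ t h).choose else 0

lemma proxD_pos {χ : ℝ} (h : 0 < χ) (t : ℝ) : 0 < proxD χ t := by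
  unfold proxD; rw [dif_pos h]; exact (prox_exists χ t h).choose_spec.1

lemma proxD_eq {χ : ℝ} (h : 0 < χ) (t : ℝ) :
    proxD χ t * (1 + Real.exp (proxD χ t + t)) = χ := by
  unfold proxD; rw [dif_pos h]; exact (prox_exists χ t h).choose_spec.2

lemma proxD_le {χ : ℝ} (h : 0 < χ) (t : ℝ) : proxD χ t ≤ χ := by
  have h1 := proxD_eq h t
  have h2 := proxD_pos h t
  have := Real.exp_pos (proxD χ t + t)
  nlinarith

lemma prox_aux {d d' t t' : ℝ} (hd : 0 < d) (h : d < d') (ht : t ≤ t') :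
    d * (1 + Real.exp (d + t)) < d' * (1 + Real.exp (d' + t')) := by
  have : Real.exp (d + t) < Real.exp (d' + t') := Real.exp_lt_exp.2 (by linarith)
  have h0 := Real.exp_pos (d + t)
  apply mul_lt_mul h (by linarith) (by positivity) (by linarith)

lemma proxD_anti {χ : ℝ} (h : 0 < χ) : Antitone (proxD χ) := by
  intro t t' ht
  by_contra! hc
  have := prox_aux (proxD_pos h t) hc ht
  rw [proxD_eq h, proxD_eq h] at this
  exact lt_irrefl _ this

lemma proxD_mono {χ χ' : ℝ} (h : 0 < χ) (hh : χ ≤ χ') (t : ℝ) : proxD χ t ≤ proxD χ' t := by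
  by_contra! hc
  have := prox_aux (proxD_pos (h.trans_le hh) t) hc (le_refl t)
  rw [proxD_eq h, proxD_eq (h.trans_le hh)] at this
  linarith

lemma proxD_ratio {χ χ' : ℝ} (h : 0 < χ) (hh : χ ≤ χ') (t : ℝ) :
    proxD χ' t ≤ χ' / χ * proxD χ t := by
  have h' := h.trans_le hh
  have e1 := proxD_eq h t
  have e2 := proxD_eq h' t
  have m := proxD_mono h hh t
  have p1 := proxD_pos h t
  have p2 := proxD_pos h' t
  have : Real.exp (proxD χ t + t) ≤ Real.exp (proxD χ' t + t) := Real.exp_le_exp.2 (by linarith)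
  rw [div_mul_eq_mul_div, le_div_iff₀ h]
  set a := proxD χ t
  set b := proxD χ' t
  rw [← e1, ← e2]
  have := mul_le_mul_of_nonneg_left this (mul_pos p1 p2).le
  nlinarith

lemma prox_key {χ : ℝ} (h : 0 < χ) (t e : ℝ) :
    proxD χ t ^ 2 / (2 * χ) + logisticLoss (proxD χ t + t) + (e - proxD χ t) ^ 2 / (2 * χ)
      ≤ e ^ 2 / (2 * χ) + logisticLoss (e + t) := by
  have e1 := proxD_eq h t
  have p1 := proxD_pos h t
  have ht := ll_tangent (e + t) (proxD χ t + t)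
  set d := proxD χ t
  have hE := Real.exp_pos (d + t)
  have : (e + t - (d + t)) / (1 + Real.exp (d + t)) = (e - d) * d / χ := by
    rw [← e1]; field_simp; ring
  rw [this] at ht
  have : e ^ 2 / (2 * χ) = d ^ 2 / (2 * χ) + (e - d) ^ 2 / (2 * χ) + (e - d) * d / χ := by
    field_simp; ring
  linarith

lemma prox_inf {χ : ℝ} (h : 0 < χ) (x c : ℝ) :
    (⨅ s : ℝ, ((s - x) ^ 2 / (2 * χ) + logisticLoss (s - c))) =
      proxD χ (x - c) ^ 2 / (2 * χ) + logisticLoss (proxD χ (x - c) + (x - c)) := by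
  apply le_antisymm
  · refine (ciInf_le ⟨0, ?_⟩ (x + proxD χ (x - c))).trans (le_of_eq ?_)
    · rintro _ ⟨s, rfl⟩
      have := ll_nonneg (s - c)
      positivity
    · congr 2
      · ring
      · ring
  · apply le_ciInf
    intro s
    have := prox_key h (x - c) (s - x)
    rw [show s - x + (x - c) = s - c by ring] at this
    have h2 : 0 ≤ (s - x - proxD χ (x - c)) ^ 2 / (2 * χ) := by positivity
    linarith

lemma proxD_meas {χ : ℝ} (h : 0 < χ) (ν c : ℝ) : Measurable (fun g => proxD χ (ν * g - c)) :=
  (proxD_anti h).measurable.comp (by fun_prop)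

lemma proxD_int {χ : ℝ} (h : 0 < χ) (ν c : ℝ) :
    Integrable (fun g => proxD χ (ν * g - c)) (gaussianReal 0 1) := by
  refine Integrable.mono' (integrable_const χ) (proxD_meas h ν c).aestronglyMeasurable ?_
  filter_upwards with g
  rw [Real.norm_of_nonneg (proxD_pos h _).le]
  exact proxD_le h _

lemma sq_int {f : ℝ → ℝ} (hf : Measurable f) (K : ℝ) (hK : ∀ g, |f g| ≤ K) :
    Integrable (fun g => f g ^ 2) (gaussianReal 0 1) := by
  refine Integrable.mono' (integrable_const (K ^ 2)) (hf.pow_const 2).aestronglyMeasurable ?_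
  filter_upwards with g
  rw [Real.norm_of_nonneg (by positivity), ← sq_abs]
  gcongr
  exact hK g

lemma proxD_abs {χ : ℝ} (h : 0 < χ) (t : ℝ) : |proxD χ t| ≤ χ := by
  rw [abs_of_pos (proxD_pos h t)]; exact proxD_le h t

lemma proxD_sq_int {χ : ℝ} (h : 0 < χ) (ν c : ℝ) :
    Integrable (fun g => proxD χ (ν * g - c) ^ 2) (gaussianReal 0 1) :=
  sq_int (proxD_meas h ν c) χ (fun _ => proxD_abs h _)

/-- second moment of the displacement -/
def BB (ν c χ : ℝ) : ℝ := ∫ g, proxD χ (ν * g - c) ^ 2 ∂(gaussianReal 0 1)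

/-- loss at the proximal point -/
def LL (ν c χ : ℝ) : ℝ :=
  ∫ g, logisticLoss (proxD χ (ν * g - c) + (ν * g - c)) ∂(gaussianReal 0 1)

lemma LL_int {χ : ℝ} (h : 0 < χ) (ν c : ℝ) :
    Integrable (fun g => logisticLoss (proxD χ (ν * g - c) + (ν * g - c))) (gaussianReal 0 1) :=
  int_ll_of ((proxD_int h ν c).add (int_aff ν c))

lemma moreau_eq (r β ν : ℝ) {χ : ℝ} (h : 0 < χ) :
    scalarMoreau r β ν χ =
      BB ν (scalarTAM r β ν) χ / (2 * χ) + LL ν (scalarTAM r β ν) χ := by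
  unfold scalarMoreau BB LL
  simp_rw [prox_inf h]
  rw [integral_add ((proxD_sq_int h _ _).div_const _) (LL_int h _ _), integral_div]

lemma moreau_le (r β ν : ℝ) {χ : ℝ} (h : 0 < χ) {f : ℝ → ℝ} (hf : Measurable f) (K : ℝ)
    (hK : ∀ g, |f g| ≤ K) :
    scalarMoreau r β ν χ +
      (∫ g, (f g - proxD χ (ν * g - scalarTAM r β ν)) ^ 2 ∂(gaussianReal 0 1)) / (2 * χ) ≤
      (∫ g, f g ^ 2 ∂(gaussianReal 0 1)) / (2 * χ) +
        ∫ g, logisticLoss (f g + (ν * g - scalarTAM r β ν)) ∂(gaussianReal 0 1) := by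
  rw [moreau_eq r β ν h]
  set c := scalarTAM r β ν
  unfold BB LL
  have hfi : Integrable f (gaussianReal 0 1) := by
    refine Integrable.mono' (integrable_const K) hf.aestronglyMeasurable ?_
    filter_upwards with g
    exact hK g
  have i1 := (proxD_sq_int h ν c).div_const (2 * χ)
  have i2 := LL_int h ν c
  have i3 : Integrable (fun g => (f g - proxD χ (ν * g - c)) ^ 2 / (2 * χ)) (gaussianReal 0 1) :=
    (sq_int (hf.sub (proxD_meas h ν c)) (K + χ) (fun g =>
      (abs_sub _ _).trans (add_le_add (hK g) (proxD_abs h _)))).div_const _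
  have i4 := (sq_int hf K hK).div_const (2 * χ)
  have i5 := int_ll_of (hfi.add (int_aff ν c))
  have := integral_mono ((i1.add i2).add i3) (i4.add i5) (fun g => prox_key h (ν * g - c) (f g))
  rw [integral_add' (i1.add i2) i3, integral_add' i1 i2, integral_add' i4 i5] at this
  simp only [integral_div, Pi.add_apply] at this
  exact this

lemma BB_mono {χ χ' : ℝ} (h : 0 < χ) (hh : χ ≤ χ') (ν c : ℝ) : BB ν c χ ≤ BB ν c χ' := by
  refine integral_mono (proxD_sq_int h _ _) (proxD_sq_int (h.trans_le hh) _ _) (fun g => ?_)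
  have := proxD_pos h (ν * g - c)
  have := proxD_mono h hh (ν * g - c)
  simp only
  gcongr

lemma BB_ratio {χ χ' : ℝ} (h : 0 < χ) (hh : χ ≤ χ') (ν c : ℝ) :
    BB ν c χ' ≤ (χ' / χ) ^ 2 * BB ν c χ := by
  unfold BB
  rw [← integral_const_mul]
  refine integral_mono (proxD_sq_int (h.trans_le hh) _ _)
    ((proxD_sq_int h _ _).const_mul _) (fun g => ?_)
  have := proxD_pos (h.trans_le hh) (ν * g - c)
  have := proxD_ratio h hh (ν * g - c)
  simp only
  rw [← mul_pow]
  gcongr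

lemma BB_cont (ν c : ℝ) : ContinuousOn (BB ν c) (Set.Ioi 0) := by
  intro x hx
  have hx : 0 < x := hx
  apply ContinuousAt.continuousWithinAt
  have hc : ContinuousAt (fun y => (y / x) ^ 2 * BB ν c x) x := by fun_prop
  have l1 : Filter.Tendsto (fun y => min (BB ν c x) ((y / x) ^ 2 * BB ν c x)) (nhds x)
      (nhds (BB ν c x)) := by
    have := (tendsto_const_nhds (x := BB ν c x) (f := nhds x)).min hc.tendsto
    simpa [div_self hx.ne'] using this
  have l2 : Filter.Tendsto (fun y => max (BB ν c x) ((y / x) ^ 2 * BB ν c x)) (nhds x)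
      (nhds (BB ν c x)) := by
    have := (tendsto_const_nhds (x := BB ν c x) (f := nhds x)).max hc.tendsto
    simpa [div_self hx.ne'] using this
  refine tendsto_of_tendsto_of_tendsto_of_le_of_le' l1 l2 ?_ ?_
  · filter_upwards [lt_mem_nhds hx] with y hy
    rcases le_total x y with h | h
    · exact (min_le_left _ _).trans (BB_mono hx h ν c)
    · refine (min_le_right _ _).trans ?_
      have := BB_ratio hy h ν c
      calc (y / x) ^ 2 * BB ν c x ≤ (y / x) ^ 2 * ((x / y) ^ 2 * BB ν c y) := by gcongr
        _ = BB ν c y := by field_simp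
  · filter_upwards [lt_mem_nhds hx] with y hy
    rcases le_total x y with h | h
    · exact (BB_ratio hx h ν c).trans (le_max_right _ _)
    · exact (BB_mono hy h ν c).trans (le_max_left _ _)

lemma BB_small {χ : ℝ} (h : 0 < χ) (ν c : ℝ) : BB ν c χ ≤ χ ^ 2 := by
  have := integral_mono (proxD_sq_int h ν c) (integrable_const (μ := gaussianReal 0 1) (χ ^ 2))
    (fun g => by
      have := proxD_pos h (ν * g - c)
      have := proxD_le h (ν * g - c)
      simp only
      gcongr)
  simpa [BB] using this

lemma BB_large {ν : ℝ} (hν : 0 < ν) (c K : ℝ) : ∃ χ : ℝ, 0 < χ ∧ K ≤ BB ν c χ := by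
  set S : Set ℝ := Set.Iic (c / ν) with hS
  have hp : 0 < (gaussianReal 0 1).real S := by
    rw [measureReal_def]
    refine ENNReal.toReal_pos (fun h0 => ?_) (measure_ne_top _ _)
    have := gaussianReal_absolutelyContinuous' 0 (v := 1) one_ne_zero h0
    simp [hS] at this
  set p := (gaussianReal 0 1).real S
  -- choose D with D ^ 2 * p ≥ K
  set D : ℝ := |K| / p + 1 with hD
  have hD1 : 1 ≤ D := by have : 0 ≤ |K| / p := by positivity
                         linarith
  have hχ : 0 < D * (1 + Real.exp (D + 0)) := by positivity
  refine ⟨D * (1 + Real.exp (D + 0)), hχ, ?_⟩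
  have hdom : ∀ g ∈ S, D ^ 2 ≤ proxD (D * (1 + Real.exp (D + 0))) (ν * g - c) ^ 2 := by
    intro g hg
    have ht : ν * g - c ≤ 0 := by
      have : g ≤ c / ν := hg
      rw [le_div_iff₀ hν] at this
      linarith
    have : D ≤ proxD (D * (1 + Real.exp (D + 0))) (ν * g - c) := by
      by_contra! hc
      have := prox_aux (proxD_pos hχ _) hc ht
      rw [proxD_eq hχ] at this
      exact lt_irrefl _ this
    gcongr
  have hi := proxD_sq_int hχ ν c
  have h1 : D ^ 2 * p ≤ BB ν c (D * (1 + Real.exp (D + 0))) := by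
    calc D ^ 2 * p = ∫ g in S, D ^ 2 ∂(gaussianReal 0 1) := by simp [p, mul_comm]
      _ ≤ ∫ g in S, proxD (D * (1 + Real.exp (D + 0))) (ν * g - c) ^ 2 ∂(gaussianReal 0 1) :=
        setIntegral_mono_on (integrable_const _) hi.integrableOn measurableSet_Iic hdom
      _ ≤ _ := setIntegral_le_integral hi (by filter_upwards with g; positivity)
  have h2 : D * p = |K| + p := by rw [hD]; field_simp
  have := le_abs_self K
  nlinarith [mul_pos (lt_of_lt_of_le one_pos hD1) hp]

lemma BB_surj {ν : ℝ} (hν : 0 < ν) (c K : ℝ) (hK : 0 < K) : ∃ χ : ℝ, 0 < χ ∧ BB ν c χ = K := by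
  obtain ⟨x, hx, hxK⟩ := BB_large hν c K
  set y := min x (Real.sqrt K)
  have hy : 0 < y := lt_min hx (Real.sqrt_pos.2 hK)
  have hyK : BB ν c y ≤ K := by
    refine (BB_small hy ν c).trans ?_
    calc y ^ 2 ≤ (Real.sqrt K) ^ 2 := by gcongr; exact min_le_right _ _
      _ = K := Real.sq_sqrt hK.le
  have := intermediate_value_Icc (min_le_left x (Real.sqrt K))
    ((BB_cont ν c).mono (fun z hz => lt_of_lt_of_le hy hz.1))
  obtain ⟨z, hz, hzK⟩ := this ⟨hyK, hxK⟩
  exact ⟨z, lt_of_lt_of_le hy hz.1, hzK⟩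

lemma pot_eq {α r β lam ν χ : ℝ} (h : 0 < χ)
    (hB : BB ν (scalarTAM r β ν) χ = ν ^ 2 / α) :
    saddlePotential α r β lam ν χ = lam / 2 * ν ^ 2 + LL ν (scalarTAM r β ν) χ := by
  unfold saddlePotential
  rw [moreau_eq r β ν h, hB, div_div, mul_assoc, mul_left_comm]
  ring

lemma pot_le {α r β lam ν χ χ' : ℝ} (h : 0 < χ) (h' : 0 < χ')
    (hB : BB ν (scalarTAM r β ν) χ = ν ^ 2 / α) :
    saddlePotential α r β lam ν χ' + (∫ g, (proxD χ (ν * g - scalarTAM r β ν)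
        - proxD χ' (ν * g - scalarTAM r β ν)) ^ 2 ∂(gaussianReal 0 1)) / (2 * χ')
      ≤ saddlePotential α r β lam ν χ := by
  rw [pot_eq h hB]
  have := moreau_le r β ν h' (proxD_meas h ν (scalarTAM r β ν)) χ (fun _ => proxD_abs h _)
  change _ ≤ BB ν (scalarTAM r β ν) χ / (2 * χ') + LL ν (scalarTAM r β ν) χ at this
  rw [hB, div_div] at this
  unfold saddlePotential
  rw [show 2 * α * χ' = α * (2 * χ') by ring]
  linarith

lemma softplus_eq (β t : ℝ) : softplus β t = logisticLoss (-(β * t)) / β := by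
  simp [softplus, logisticLoss]

lemma softplus_int (β ν μ : ℝ) :
    Integrable (fun z => softplus β (ν * z - μ)) (gaussianReal 0 1) := by
  simp_rw [softplus_eq]
  exact (int_ll_of ((int_aff ν μ).const_mul β).neg).div_const β

/-- the objective of the scalar TAM functional -/
def HH (r β ν μ : ℝ) : ℝ := μ + (1 / r) * ∫ z, softplus β (ν * z - μ) ∂gaussianReal 0 1

lemma HH_nonneg {r β : ℝ} (hr0 : 0 < r) (hr1 : r < 1) (hβ : 0 < β) (ν μ : ℝ) :
    0 ≤ HH r β ν μ := by
  have h0 : 0 ≤ ∫ z, softplus β (ν * z - μ) ∂gaussianReal 0 1 := by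
    apply integral_nonneg
    intro z
    simp only [softplus_eq, Pi.zero_apply]
    exact div_nonneg (ll_nonneg _) hβ.le
  have h1 : -μ ≤ ∫ z, softplus β (ν * z - μ) ∂gaussianReal 0 1 := by
    have := integral_mono (int_aff ν μ) (softplus_int β ν μ) (fun z => by
      simp only [softplus_eq]
      rw [le_div_iff₀ hβ]
      have := ll_ge (-(β * (ν * z - μ)))
      linarith)
    rw [integral_sub (int_id.const_mul ν) (integrable_const _), integral_const_mul, int_mean] at this
    simpa using this
  unfold HH
  have hr : 1 ≤ 1 / r := by rw [le_div_iff₀ hr0]; linarith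
  nlinarith

lemma HH_convex {r β : ℝ} (hr0 : 0 < r) (hβ : 0 < β) (a b ν₁ ν₂ μ₁ μ₂ : ℝ)
    (ha : 0 ≤ a) (hb : 0 ≤ b) (hab : a + b = 1) :
    HH r β (a * ν₁ + b * ν₂) (a * μ₁ + b * μ₂) ≤ a * HH r β ν₁ μ₁ + b * HH r β ν₂ μ₂ := by
  unfold HH
  have := integral_mono (softplus_int β (a * ν₁ + b * ν₂) (a * μ₁ + b * μ₂))
    (((softplus_int β ν₁ μ₁).const_mul a).add ((softplus_int β ν₂ μ₂).const_mul b)) (fun z => by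
      simp only [softplus_eq, Pi.add_apply]
      have h := ll_convex a b (-(β * (ν₁ * z - μ₁))) (-(β * (ν₂ * z - μ₂))) ha hb hab
      rw [← mul_div_assoc, ← mul_div_assoc, ← add_div]
      apply div_le_div_of_nonneg_right _ hβ.le
      refine le_trans (le_of_eq ?_) h
      congr 1
      ring)
  rw [integral_add' ((softplus_int β ν₁ μ₁).const_mul a) ((softplus_int β ν₂ μ₂).const_mul b),
    integral_const_mul, integral_const_mul] at this
  have := mul_le_mul_of_nonneg_left this (one_div_pos.2 hr0).le
  linarith

lemma TAM_convex {r β : ℝ} (hr0 : 0 < r) (hr1 : r < 1) (hβ : 0 < β) (a b ν₁ ν₂ : ℝ)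
    (ha : 0 ≤ a) (hb : 0 ≤ b) (hab : a + b = 1) :
    scalarTAM r β (a * ν₁ + b * ν₂) ≤ a * scalarTAM r β ν₁ + b * scalarTAM r β ν₂ := by
  have hT : ∀ ν, scalarTAM r β ν = ⨅ μ, HH r β ν μ := fun _ => rfl
  have hbd : ∀ ν, BddBelow (Set.range (HH r β ν)) := fun ν =>
    ⟨0, by rintro _ ⟨μ, rfl⟩; exact HH_nonneg hr0 hr1 hβ ν μ⟩
  apply le_of_forall_pos_le_add
  intro ε hε
  obtain ⟨μ₁, h₁⟩ := exists_lt_of_ciInf_lt (show ⨅ μ, HH r β ν₁ μ < scalarTAM r β ν₁ + ε by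
    rw [← hT]; linarith)
  obtain ⟨μ₂, h₂⟩ := exists_lt_of_ciInf_lt (show ⨅ μ, HH r β ν₂ μ < scalarTAM r β ν₂ + ε by
    rw [← hT]; linarith)
  have h3 := ciInf_le (hbd (a * ν₁ + b * ν₂)) (a * μ₁ + b * μ₂)
  rw [← hT] at h3
  have h4 := HH_convex hr0 hβ a b ν₁ ν₂ μ₁ μ₂ ha hb hab
  have h5 : a * ε + b * ε = ε := by rw [← add_mul, hab, one_mul]
  nlinarith

lemma sup_eq {α r β lam ν χ : ℝ} (h : 0 < χ)
    (hB : BB ν (scalarTAM r β ν) χ = ν ^ 2 / α) :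
    reducedPotential α r β lam ν = lam / 2 * ν ^ 2 + LL ν (scalarTAM r β ν) χ := by
  have hle : ∀ χ' : {x : ℝ // 0 < x}, saddlePotential α r β lam ν χ' ≤
      saddlePotential α r β lam ν χ := by
    rintro ⟨χ', h'⟩
    have := pot_le (lam := lam) h h' hB
    refine le_trans ?_ this
    have : 0 ≤ ∫ g, (proxD χ (ν * g - scalarTAM r β ν)
        - proxD χ' (ν * g - scalarTAM r β ν)) ^ 2 ∂(gaussianReal 0 1) :=
      integral_nonneg (fun g => by positivity)
    simp only [le_add_iff_nonneg_right]
    positivity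
  rw [← pot_eq h hB]
  haveI : Nonempty {x : ℝ // 0 < x} := ⟨⟨χ, h⟩⟩
  unfold reducedPotential
  apply le_antisymm (ciSup_le hle)
  exact le_ciSup (f := fun χ : {x : ℝ // 0 < x} => saddlePotential α r β lam ν χ)
    ⟨_, by rintro _ ⟨χ', rfl⟩; exact hle χ'⟩ ⟨χ, h⟩

lemma red_convex {α r β lam : ℝ} (hα : 0 < α) (hr0 : 0 < r) (hr1 : r < 1) (hβ : 0 < β)
    {a b x y : ℝ} (hx : 0 < x) (hy : 0 < y) (ha : 0 ≤ a) (hb : 0 ≤ b) (hab : a + b = 1) :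
    reducedPotential α r β lam (a * x + b * y) - lam / 2 * (a * x + b * y) ^ 2 ≤
      a * (reducedPotential α r β lam x - lam / 2 * x ^ 2) +
      b * (reducedPotential α r β lam y - lam / 2 * y ^ 2) := by
  obtain ⟨χ₁, h₁, hB₁⟩ := BB_surj hx (scalarTAM r β x) (x ^ 2 / α) (by positivity)
  obtain ⟨χ₂, h₂, hB₂⟩ := BB_surj hy (scalarTAM r β y) (y ^ 2 / α) (by positivity)
  rw [sup_eq h₁ hB₁, sup_eq h₂ hB₂, add_sub_cancel_left, add_sub_cancel_left]
  have hc := TAM_convex hr0 hr1 hβ a b x y ha hb hab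
  set ν := a * x + b * y with hν
  have hν0 : 0 < ν := by
    rcases ha.eq_or_lt with h | h
    · subst h
      have : b = 1 := by linarith
      rw [hν, this]; linarith
    · have := mul_pos h hx
      have := mul_nonneg hb hy.le
      linarith
  rw [sub_le_iff_le_add']
  haveI : Nonempty {x : ℝ // 0 < x} := ⟨⟨1, one_pos⟩⟩
  apply ciSup_le
  rintro ⟨χ, h⟩
  simp only
  set c₁ := scalarTAM r β x
  set c₂ := scalarTAM r β y
  set f : ℝ → ℝ := fun g => a * proxD χ₁ (x * g - c₁) + b * proxD χ₂ (y * g - c₂) with hf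
  have fm : Measurable f :=
    ((proxD_meas h₁ x c₁).const_mul a).add ((proxD_meas h₂ y c₂).const_mul b)
  have fb : ∀ g, |f g| ≤ a * χ₁ + b * χ₂ := by
    intro g
    have := proxD_pos h₁ (x * g - c₁)
    have := proxD_pos h₂ (y * g - c₂)
    rw [abs_of_nonneg (by positivity)]
    have := proxD_le h₁ (x * g - c₁)
    have := proxD_le h₂ (y * g - c₂)
    simp only [hf]
    gcongr
  have key := moreau_le r β ν h fm _ fb
  have n0 : 0 ≤ (∫ g, (f g - proxD χ (ν * g - scalarTAM r β ν)) ^ 2 ∂(gaussianReal 0 1))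
      / (2 * χ) := by
    refine div_nonneg (integral_nonneg (fun g => by positivity)) (by positivity)
  have q1 : ∫ g, f g ^ 2 ∂(gaussianReal 0 1) ≤ ν ^ 2 / α := by
    have i1 := ((proxD_sq_int h₁ x c₁).const_mul (ν * (a / x)))
    have i2 := ((proxD_sq_int h₂ y c₂).const_mul (ν * (b / y)))
    have := integral_mono (sq_int fm _ fb) (i1.add i2) (fun g => by
        simp only [hf, Pi.add_apply]
        generalize proxD χ₁ (x * g - c₁) = u
        generalize proxD χ₂ (y * g - c₂) = v
        rw [← sub_nonneg]
        have : ν * (a / x) * u ^ 2 + ν * (b / y) * v ^ 2 - (a * u + b * v) ^ 2 =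
          a * b * (y * u - x * v) ^ 2 / (x * y) := by
          rw [hν]; field_simp; ring
        rw [this]
        positivity)
    rw [integral_add' i1 i2, integral_const_mul, integral_const_mul] at this
    change _ ≤ ν * (a / x) * BB x c₁ χ₁ + ν * (b / y) * BB y c₂ χ₂ at this
    rw [hB₁, hB₂] at this
    refine this.trans (le_of_eq ?_)
    have : ν ^ 2 = ν * (a * x + b * y) := by rw [← hν]; ring
    rw [this]
    field_simp
  have q2 : ∫ g, logisticLoss (f g + (ν * g - scalarTAM r β ν)) ∂(gaussianReal 0 1) ≤
      a * LL x c₁ χ₁ + b * LL y c₂ χ₂ := by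
    have i1 := (LL_int h₁ x c₁).const_mul a
    have i2 := (LL_int h₂ y c₂).const_mul b
    have fi : Integrable f (gaussianReal 0 1) :=
      ((proxD_int h₁ x c₁).const_mul a).add ((proxD_int h₂ y c₂).const_mul b)
    have := integral_mono (int_ll_of (fi.add (int_aff ν (scalarTAM r β ν)))) (i1.add i2)
      (fun g => by
        simp only [Pi.add_apply]
        refine le_trans (ll_anti ?_) (ll_convex a b _ _ ha hb hab)
        simp only [hf, hν]
        linarith)
    rw [integral_add' i1 i2, integral_const_mul, integral_const_mul] at this
    exact this
  unfold saddlePotential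
  have q3 : (∫ g, f g ^ 2 ∂(gaussianReal 0 1)) / (2 * χ) ≤ ν ^ 2 / (2 * α * χ) := by
    refine (div_le_div_of_nonneg_right q1 (by positivity)).trans (le_of_eq ?_)
    rw [div_div]; ring
  linarith

/-- **Well-posedness of the scalar variational problem.** Fix `α > 0`, `r ∈ (0,1)`,
`β > 0`, `λ > 0`. Then (i) for every `ν > 0`, `χ ↦ P_{α,r,λ}(ν,χ)` attains its
supremum over `(0,∞)` at a unique point, and (ii) the reduced potential is
`λ`-strongly convex on `(0,∞)`, i.e. `ν ↦ V_{α,r,λ}(ν) − (λ/2)ν²` is convex there. -/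
theorem scalar_variational_wellposed (α r β lam : ℝ) (hα : 0 < α) (hr0 : 0 < r)
    (hr1 : r < 1) (hβ : 0 < β) (hlam : 0 < lam) :
    (∀ ν : ℝ, 0 < ν →
      ∃! χ : ℝ, 0 < χ ∧ ∀ χ' : ℝ, 0 < χ' →
        saddlePotential α r β lam ν χ' ≤ saddlePotential α r β lam ν χ) ∧
    ConvexOn ℝ (Set.Ioi 0)
      (fun ν => reducedPotential α r β lam ν - lam / 2 * ν ^ 2) := by
  constructor
  · intro ν hν
    obtain ⟨χ, h, hB⟩ := BB_surj hν (scalarTAM r β ν) (ν ^ 2 / α) (by positivity)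
    have hI : ∀ χ' : ℝ, 0 ≤ ∫ g, (proxD χ (ν * g - scalarTAM r β ν)
        - proxD χ' (ν * g - scalarTAM r β ν)) ^ 2 ∂(gaussianReal 0 1) := fun χ' =>
      integral_nonneg (fun g => by positivity)
    refine ⟨χ, ⟨h, fun χ' h' => ?_⟩, ?_⟩
    · have h1 := pot_le (lam := lam) h h' hB
      have h2 := div_nonneg (hI χ') (show 0 ≤ 2 * χ' by positivity)
      linarith
    · rintro χ' ⟨h', hmax⟩
      have h1 := pot_le (lam := lam) h h' hB
      have h2 := hmax χ h
      have h3 : (∫ g, (proxD χ (ν * g - scalarTAM r β ν)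
        - proxD χ' (ν * g - scalarTAM r β ν)) ^ 2 ∂(gaussianReal 0 1)) / (2 * χ') ≤ 0 := by
        linarith
      have h4 : ∫ g, (proxD χ (ν * g - scalarTAM r β ν)
        - proxD χ' (ν * g - scalarTAM r β ν)) ^ 2 ∂(gaussianReal 0 1) = 0 := by
        refine le_antisymm ?_ (hI χ')
        rw [div_le_iff₀ (by positivity), zero_mul] at h3
        exact h3
      have hint : Integrable (fun g => (proxD χ (ν * g - scalarTAM r β ν)
        - proxD χ' (ν * g - scalarTAM r β ν)) ^ 2) (gaussianReal 0 1) :=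
        sq_int ((proxD_meas h ν _).sub (proxD_meas h' ν _)) (χ + χ') (fun g =>
          (abs_sub _ _).trans (add_le_add (proxD_abs h _) (proxD_abs h' _)))
      rw [integral_eq_zero_iff_of_nonneg (fun g => by positivity) hint] at h4
      obtain ⟨g, hg⟩ := h4.exists
      have h5 : proxD χ (ν * g - scalarTAM r β ν) = proxD χ' (ν * g - scalarTAM r β ν) := by
        simpa [sub_eq_zero] using hg
      rw [← proxD_eq h (ν * g - scalarTAM r β ν), ← proxD_eq h' (ν * g - scalarTAM r β ν), h5]
  · refine ⟨convex_Ioi 0, fun x hx y hy a b ha hb hab => ?_⟩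
    simpa only [smul_eq_mul] using red_convex (lam := lam) hα hr0 hr1 hβ hx hy ha hb hab

end
end
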